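/- Let q be an odd prime power, n ≥ 2, 1 ≤ m ≤ n − 1, d = gcd(m, n), and suppose m/d is odd. Let F be a finite field with q^n elements and a ∈ F, a ≠ 0. For x ∈ F write N(x) = x^{(q^n − 1)/(q^d − 1)}. Then the map f(c) = c^{q^m} − 2a·c^{(q^m + 1)/2} + a^2·c is a bijection of F if and only if N(a^2) ≠ 1; and in that case, defining b_{ij} = 1 if i = j and b_{ij} = 2 if i < j, h_2(x) = Σ_{1 ≤ i ≤ j ≤ n/d} a^{−(q^{i m} + q^{j m} − 2)/(q^m − 1)} · b_{ij} · x^{(q^{(i−1)m} + q^{(j−1)m})/2}, and g_2(x) = N(a^2) + 1 + 2·N(a)·x^{(q^n − 1)/2}, one has for every c ∈ F: (N(a^2)/(1 − N(a^2))^2) · g_2(f(c)) · h_2(f(c)) = c. -/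

import Mathlib

open Finset in
theorem sum_Icc_sq_eq_sum_triangle {R : Type*} [CommSemiring R] (u : ℕ → R) (k : ℕ) :
    (∑ i ∈ Icc 1 k, u i) ^ 2 =
      ∑ i ∈ Icc 1 k, ∑ j ∈ Icc i k, (if i = j then (1 : R) else 2) * (u i * u j) := by
  induction k with
  | zero => simp
  | succ k ih =>
    have h : ∀ i ∈ Icc 1 k,
        ∑ j ∈ Icc i (k + 1), (if i = j then (1 : R) else 2) * (u i * u j) =
          ∑ j ∈ Icc i k, (if i = j then (1 : R) else 2) * (u i * u j) +
            u i * (2 * u (k + 1)) := by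
      intro i hi
      have hik := (mem_Icc.1 hi).2
      rw [sum_Icc_succ_top (by omega), if_neg (by omega)]
      ring
    rw [sum_Icc_succ_top (by omega), sum_Icc_succ_top (by omega), sum_congr rfl h,
      sum_add_distrib, ← ih, ← sum_mul]
    simp
    ring

open Finset in
/-- Partial inversion of `v ↦ v ^ Q - a * v` by a telescoping sum. -/
theorem sum_inv_pow_mul_sub_pow {K : Type*} [Field K] (Q : ℕ)
    (hQ : ∀ (i : ℕ) (x y : K), (x - y) ^ Q ^ i = x ^ Q ^ i - y ^ Q ^ i)
    {a : K} (ha : a ≠ 0) (v : K) (k : ℕ) :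
    ∑ i ∈ Icc 1 k, a⁻¹ ^ (∑ l ∈ range i, Q ^ l) * (v ^ Q - a * v) ^ Q ^ (i - 1) =
      a⁻¹ ^ (∑ l ∈ range k, Q ^ l) * v ^ Q ^ k - v := by
  induction k with
  | zero => simp
  | succ k ih =>
    rw [sum_Icc_succ_top (by omega), ih, Nat.add_sub_cancel, hQ, sum_range_succ, mul_pow,
      ← pow_mul, ← pow_succ', pow_add]
    have h : a⁻¹ ^ Q ^ k * a ^ Q ^ k = 1 := by
      rw [← mul_pow, inv_mul_cancel₀ ha, one_pow]
    linear_combination (-(a⁻¹ ^ (∑ l ∈ range k, Q ^ l) * v ^ Q ^ k)) * h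

theorem pow_pow_mod_eq {M : Type*} [Monoid M] {a : M} {r k : ℕ} (h : a ^ r ^ k = a) (i : ℕ) :
    a ^ r ^ (i % k) = a ^ r ^ i := by
  have h' : ∀ j : ℕ, a ^ r ^ (k * j) = a := by
    intro j
    induction j with
    | zero => simp
    | succ j ih => rw [mul_add, pow_add, pow_mul, ih, mul_one, h]
  conv_rhs => rw [← Nat.div_add_mod i k, pow_add, pow_mul, h']

open Finset in
/-- The norm may be computed with any generator of the cyclic group of Frobenius powers. -/
theorem pow_geom_sum_eq_of_coprime {M : Type*} [CommMonoid M] {a : M} {r k t : ℕ}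
    (h : a ^ r ^ k = a) (hkt : Nat.Coprime k t) (hk : 0 < k) :
    a ^ (∑ l ∈ range k, (r ^ t) ^ l) = a ^ (∑ l ∈ range k, r ^ l) := by
  rw [← prod_pow_eq_pow_sum, ← prod_pow_eq_pow_sum]
  have hmaps : ∀ l ∈ range k, t * l % k ∈ range k := fun l _ => mem_range.2 (Nat.mod_lt _ hk)
  have hinj : Set.InjOn (fun l => t * l % k) (range k : Set ℕ) := by
    intro x hx y hy hxy
    have hxy' : x ≡ y [MOD k] := Nat.ModEq.cancel_left_of_coprime hkt hxy
    rw [coe_range, Set.mem_Iio] at hx hy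
    exact hxy'.eq_of_lt_of_lt hx hy
  refine prod_nbij (fun l => t * l % k) hmaps hinj
    (surjOn_of_injOn_of_card_le _ hmaps hinj le_rfl) ?_
  intro l _
  rw [pow_pow_mod_eq h, pow_mul]

theorem IsCyclic.exists_pow_eq {G : Type*} [Group G] [Finite G] [IsCyclic G] {e s t : ℕ}
    (hG : Nat.card G = e * s) (hst : Nat.Coprime s t) {a : G} (ha : a ^ s = 1) :
    ∃ x : G, x ^ (e * t) = a := by
  have hpos : 0 < s := by
    have : 0 < e * s := hG ▸ Nat.card_pos
    exact Nat.pos_of_mul_pos_left this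
  obtain ⟨g, hg⟩ := IsCyclic.exists_generator (α := G)
  obtain ⟨j, rfl⟩ := mem_powers_iff_mem_zpowers.2 (hg a)
  have hj : e ∣ j := by
    have h := orderOf_dvd_of_pow_eq_one (x := g) (n := j * s) (by rw [pow_mul]; exact ha)
    rw [orderOf_eq_card_of_forall_mem_zpowers hg, hG] at h
    exact Nat.dvd_of_mul_dvd_mul_right hpos h
  obtain ⟨j, rfl⟩ := hj
  obtain ⟨u, hu⟩ := exists_pow_eq_self_of_coprime (x := g ^ (e * j)) (n := t)
    (hst.symm.coprime_dvd_right (orderOf_dvd_of_pow_eq_one ha))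
  refine ⟨g ^ (j * u), ?_⟩
  simp only at hu ⊢
  rw [← hu, ← pow_mul, ← pow_mul, ← pow_mul]
  congr 1
  ring

theorem pow_mul_sub_one_div_two_of_sq_eq_one {M : Type*} [Monoid M] {c : M} {r t : ℕ}
    (hr : Odd r) (ht : Odd t) (hc : (c ^ ((r - 1) / 2)) ^ 2 = 1) :
    c ^ ((r ^ t - 1) / 2) = c ^ ((r - 1) / 2) := by
  have hsum : Odd (∑ l ∈ Finset.range t, r ^ l) := by
    rw [Finset.odd_sum_iff_odd_card_odd,
      Finset.filter_true_of_mem fun l _ => hr.pow, Finset.card_range]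
    exact ht
  obtain ⟨e, rfl⟩ := hr
  have h := geom_sum_mul_of_one_le (x := 2 * e + 1) (by omega) t
  rw [Nat.add_sub_cancel] at h
  have he : ((2 * e + 1) ^ t - 1) / 2 = e * ∑ l ∈ Finset.range t, (2 * e + 1) ^ l := by
    rw [← h, mul_left_comm, Nat.mul_div_cancel_left _ two_pos, mul_comm]
  have he' : (2 * e + 1 - 1) / 2 = e := by omega
  obtain ⟨s, hs⟩ := hsum
  rw [he'] at hc ⊢
  rw [he, hs, pow_mul, pow_succ, pow_mul, hc, one_pow, one_mul]


/-- For `q` odd, `m/d` odd: `f(x) = x^{q^m} - 2a x^{(q^m+1)/2} + a^2 x`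
permutes `F = 𝔽_{q^n}` iff `N(a^2) ≠ 1`, and in that case its inverse is
`(N(a^2)/(1 - N(a^2))^2) g₂(x) h₂(x)`. -/
theorem stmt_10 (q n m : ℕ) (hq : IsPrimePow q) (hq2 : Odd q) (hn : 2 ≤ n)
    (hm1 : 1 ≤ m) (hm2 : m ≤ n - 1)
    (d : ℕ) (hd : d = Nat.gcd m n) (hmd : Odd (m / d))
    (F : Type*) [Field F] [Fintype F] (hF : Fintype.card F = q ^ n)
    (a : F) (ha : a ≠ 0)
    (N : F → F) (hN : ∀ x, N x = x ^ ((q ^ n - 1) / (q ^ d - 1)))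
    (f : F → F)
    (hf : ∀ c, f c = c ^ (q ^ m) - 2 * a * c ^ ((q ^ m + 1) / 2) + a ^ 2 * c)
    (h₂ : F → F)
    (hh₂ : ∀ x, h₂ x = ∑ i ∈ Finset.Icc 1 (n / d), ∑ j ∈ Finset.Icc i (n / d),
      (a⁻¹) ^ ((q ^ (i * m) + q ^ (j * m) - 2) / (q ^ m - 1)) *
        (if i = j then (1 : F) else 2) *
          x ^ ((q ^ ((i - 1) * m) + q ^ ((j - 1) * m)) / 2))
    (g₂ : F → F)
    (hg₂ : ∀ x, g₂ x = N (a ^ 2) + 1 + 2 * N a * x ^ ((q ^ n - 1) / 2)) :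
    (Function.Bijective f ↔ N (a ^ 2) ≠ 1) ∧
      (N (a ^ 2) ≠ 1 → ∀ c : F,
        (N (a ^ 2) / (1 - N (a ^ 2)) ^ 2) * g₂ (f c) * h₂ (f c) = c) := by
  classical
  have hq1 : 1 < q := hq.one_lt
  have hdm : d ∣ m := hd ▸ Nat.gcd_dvd_left m n
  have hdn : d ∣ n := hd ▸ Nat.gcd_dvd_right m n
  have hd0 : 0 < d := Nat.pos_of_dvd_of_pos hdm hm1
  obtain ⟨t, rfl⟩ := hdm
  obtain ⟨k, rfl⟩ := hdn
  rw [Nat.mul_div_cancel_left _ hd0] at hmd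
  have hk0 : 0 < k := by
    rcases Nat.eq_zero_or_pos k with rfl | h
    · simp at hn
    · exact h
  have hkt : Nat.Coprime k t := by
    rw [Nat.gcd_mul_left] at hd
    have h : d * Nat.gcd t k = d * 1 := by omega
    exact Nat.Coprime.symm (Nat.eq_of_mul_eq_mul_left hd0 h)
  have hrodd : Odd (q ^ d) := hq2.pow
  have hr2 : 2 ≤ q ^ d := Nat.one_lt_pow hd0.ne' hq1
  have hQodd : Odd (q ^ (d * t)) := hq2.pow
  have hQ2 : 2 ≤ q ^ (d * t) := Nat.one_lt_pow (by omega) hq1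
  have hnorm : (q ^ (d * k) - 1) / (q ^ d - 1) = ∑ l ∈ Finset.range k, (q ^ d) ^ l := by
    rw [Nat.geomSum_eq hr2, ← pow_mul]
  have hcard : ∀ x : F, x ^ (q ^ d) ^ k = x := fun x => by
    rw [← pow_mul, ← hF, FiniteField.pow_card]
  have hNgeom : ∀ x, N x = x ^ (∑ l ∈ Finset.range k, (q ^ (d * t)) ^ l) := fun x => by
    rw [hN, hnorm, pow_mul q d t, pow_geom_sum_eq_of_coprime (hcard x) hkt hk0]
  have hNsq : N (a ^ 2) = N a ^ 2 := by rw [hN, hN, ← pow_mul, ← pow_mul, mul_comm]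
  have hNa : N a ≠ 0 := by rw [hN]; exact pow_ne_zero _ ha
  have hfactor : ∀ c, f c = c * (c ^ ((q ^ (d * t) - 1) / 2) - a) ^ 2 := fun c => by
    rw [hf]
    obtain ⟨e, he⟩ := hQodd
    rw [he, show (2 * e + 1 + 1) / 2 = e + 1 by omega, show (2 * e + 1 - 1) / 2 = e by omega]
    ring
  have hf0 : f 0 = 0 := by rw [hfactor, zero_mul]
  have hpow : ∀ c : F, c ≠ 0 → c ^ (q ^ (d * k) - 1) = 1 := fun c hc => by
    rw [← hF]; exact FiniteField.pow_card_sub_one_eq_one c hc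
  have hnodd : Odd (q ^ (d * k)) := hq2.pow
  have hn2 : (q ^ (d * k) - 1) / 2 * 2 = q ^ (d * k) - 1 :=
    Nat.div_mul_cancel (Nat.Odd.sub_odd hnodd odd_one).two_dvd
  have hchar : ∀ c : F, c ≠ 0 → (c ^ ((q ^ (d * k) - 1) / 2)) ^ 2 = 1 := fun c hc => by
    rw [← pow_mul, hn2, hpow c hc]
  -- A nonzero root of `f` exists when `N (a ^ 2) = 1`.
  have hroot : N (a ^ 2) = 1 → ∃ x : F, x ≠ 0 ∧ f x = 0 := by
    intro h
    obtain ⟨e, he⟩ := hrodd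
    set S := ∑ l ∈ Finset.range k, (q ^ d) ^ l with hS
    set T := ∑ l ∈ Finset.range t, (q ^ d) ^ l with hT
    have hS' : S * (q ^ d - 1) = q ^ (d * k) - 1 := by
      rw [pow_mul]; exact geom_sum_mul_of_one_le (by omega) k
    have hT' : T * (q ^ d - 1) = q ^ (d * t) - 1 := by
      rw [pow_mul]; exact geom_sum_mul_of_one_le (by omega) t
    have hTodd : Odd T := by
      rw [hT, Finset.odd_sum_iff_odd_card_odd,
        Finset.filter_true_of_mem fun l _ => hq2.pow.pow, Finset.card_range]
      exact hmd
    have hST : Nat.Coprime S T := by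
      have hg := Nat.pow_sub_one_gcd_pow_sub_one q (d * k) (d * t)
      rw [← hS', ← hT', Nat.gcd_mul_right, Nat.gcd_mul_left, hkt, mul_one] at hg
      exact Nat.eq_of_mul_eq_mul_right (by omega : 0 < q ^ d - 1) (by rw [hg, one_mul])
    have he' : q ^ d - 1 = 2 * e := by omega
    have hunits : Nat.card Fˣ = e * (2 * S) := by
      rw [Nat.card_units, Nat.card_eq_fintype_card, hF, ← hS', he']
      ring
    obtain ⟨x, hx⟩ := IsCyclic.exists_pow_eq hunits (t := T)
      (Nat.Coprime.mul_left (Nat.coprime_two_left.2 hTodd) hST) (a := Units.mk0 a ha) (by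
        ext
        rw [hN, hnorm, ← pow_mul] at h
        simpa using h)
    refine ⟨x, x.ne_zero, ?_⟩
    have hx' : (x : F) ^ (e * T) = a := by
      rw [← Units.val_pow_eq_pow_val, hx, Units.val_mk0]
    have heT : (q ^ (d * t) - 1) / 2 = e * T := by
      rw [← hT', he', mul_left_comm, Nat.mul_div_cancel_left _ two_pos, mul_comm]
    rw [hfactor, heT, hx', sub_self, zero_pow two_ne_zero, mul_zero]
  have hinv : N (a ^ 2) ≠ 1 → ∀ c : F,
      (N (a ^ 2) / (1 - N (a ^ 2)) ^ 2) * g₂ (f c) * h₂ (f c) = c := by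
    intro hne c
    rw [Nat.mul_div_cancel_left _ hd0] at hh₂
    rcases eq_or_ne c 0 with rfl | hc
    · have h0 : h₂ 0 = 0 := by
        rw [hh₂]
        refine Finset.sum_eq_zero fun i _ => Finset.sum_eq_zero fun j _ => ?_
        have h1 : 0 < q ^ ((i - 1) * (d * t)) := by positivity
        have h2 : 0 < q ^ ((j - 1) * (d * t)) := by positivity
        rw [zero_pow (by omega), mul_zero]
      rw [hf0, h0, mul_zero]
    set z := c ^ ((q ^ (d * t) - 1) / 2) - a with hz
    set ε := c ^ ((q ^ (d * k) - 1) / 2) with hε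
    have hε2 : ε ^ 2 = 1 := hchar c hc
    have hz0 : z ≠ 0 := by
      intro h
      apply hne
      have hca : a ^ 2 = c ^ (q ^ (d * t) - 1) := by
        rw [← sub_eq_zero.1 h, ← pow_mul, Nat.div_mul_cancel (Nat.Odd.sub_odd hQodd odd_one).two_dvd]
      rw [hNgeom, hca, ← pow_mul, mul_comm, geom_sum_mul_of_one_le (by omega)]
      obtain ⟨u, hu⟩ : q ^ (d * k) - 1 ∣ (q ^ (d * t)) ^ k - 1 := by
        rw [← pow_mul, mul_right_comm, pow_mul q (d * k) t]
        exact Nat.sub_one_dvd_pow_sub_one _ _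
      rw [hu, pow_mul, hpow c hc, one_pow]
    have hg : g₂ (f c) = (N a + ε) ^ 2 := by
      rw [hg₂, hfactor, ← hz, mul_pow, ← hε, pow_right_comm, hchar z hz0, hNsq]
      linear_combination -hε2
    have hh : h₂ (f c) = c * ((N a)⁻¹ * ε - 1) ^ 2 := by
      obtain ⟨p, r, hp, -, hpr⟩ := hq
      have : Fact p.Prime := ⟨hp.nat_prime⟩
      have : CharP F p := by
        obtain ⟨p', hp'⟩ := CharP.exists F
        obtain ⟨s, hprime, hs⟩ := FiniteField.card F p'
        have hdvd : p' ∣ p := by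
          refine hprime.dvd_of_dvd_pow (n := r * (d * k)) ?_
          rw [pow_mul, hpr, ← hF, hs]
          exact dvd_pow_self _ s.ne_zero
        rwa [(Nat.prime_dvd_prime_iff_eq hprime hp.nat_prime).1 hdvd] at hp'
      let K := AlgebraicClosure F
      have : CharP K p := charP_of_injective_algebraMap (algebraMap F K).injective p
      let φ : F →+* K := algebraMap F K
      have hfrob : ∀ (i : ℕ) (x y : K),
          (x - y) ^ (q ^ (d * t)) ^ i = x ^ (q ^ (d * t)) ^ i - y ^ (q ^ (d * t)) ^ i := by
        intro i x y
        rw [← hpr, ← pow_mul, ← pow_mul]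
        exact sub_pow_char_pow x y _
      obtain ⟨v, hv⟩ := IsAlgClosed.exists_pow_nat_eq (φ c) two_pos
      have hodd : ∀ Q : ℕ, Odd Q → v ^ Q = v * φ (c ^ ((Q - 1) / 2)) := by
        rintro Q ⟨e, rfl⟩
        rw [show (2 * e + 1 - 1) / 2 = e by omega, map_pow, ← hv]
        ring
      have hw : (v ^ q ^ (d * t) - φ a * v) ^ 2 = φ (f c) := by
        rw [hodd _ hQodd, hfactor, map_mul, ← hv, map_pow φ _ 2, map_sub]
        ring
      have hvk : v ^ (q ^ (d * t)) ^ k = v * φ ε := by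
        rw [hodd _ hQodd.pow, ← pow_mul, mul_right_comm, pow_mul q (d * k) t,
          pow_mul_sub_one_div_two_of_sq_eq_one hnodd hmd hε2]
      have hsum := sum_inv_pow_mul_sub_pow _ hfrob ((map_ne_zero φ).2 ha) v k
      rw [hvk] at hsum
      apply φ.injective
      have hexp : ∀ i j : ℕ, (q ^ (i * (d * t)) + q ^ (j * (d * t)) - 2) / (q ^ (d * t) - 1) =
          ∑ l ∈ Finset.range i, (q ^ (d * t)) ^ l + ∑ l ∈ Finset.range j, (q ^ (d * t)) ^ l := by
        intro i j
        have h1 := geom_sum_mul_of_one_le (x := q ^ (d * t)) (by omega) i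
        have h2 := geom_sum_mul_of_one_le (x := q ^ (d * t)) (by omega) j
        have h3 : 0 < (q ^ (d * t)) ^ i := by positivity
        have h4 : 0 < (q ^ (d * t)) ^ j := by positivity
        rw [mul_comm i, mul_comm j, pow_mul q (d * t), pow_mul q (d * t)]
        refine Nat.div_eq_of_eq_mul_left (by omega) ?_
        rw [add_mul, h1, h2]
        omega
      have hmap : φ (h₂ (f c)) = (v * φ ((N a)⁻¹ * ε - 1)) ^ 2 := by
        have hs : v * φ ((N a)⁻¹ * ε - 1) = (φ a)⁻¹ ^ (∑ l ∈ Finset.range k, (q ^ (d * t)) ^ l) *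
            (v * φ ε) - v := by
          rw [hNgeom, ← inv_pow]
          simp only [map_sub, map_mul, map_pow, map_inv₀, map_one]
          ring
        rw [hs, ← hsum, sum_Icc_sq_eq_sum_triangle, hh₂, map_sum]
        refine Finset.sum_congr rfl fun i _ => ?_
        rw [map_sum]
        refine Finset.sum_congr rfl fun j _ => ?_
        have h2 : 2 ∣ q ^ ((i - 1) * (d * t)) + q ^ ((j - 1) * (d * t)) :=
          (hq2.pow.add_odd hq2.pow).two_dvd
        rw [hexp, map_mul, map_mul, map_pow, map_pow, map_inv₀, ← hw, ← pow_mul,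
          Nat.mul_div_cancel' h2, mul_comm (i - 1), mul_comm (j - 1), pow_mul q (d * t),
          pow_mul q (d * t), pow_add, pow_add, apply_ite φ, map_one, map_ofNat]
        ring
      rw [hmap, mul_pow, hv, map_mul, map_pow]
    have hden : 1 - N a ^ 2 ≠ 0 := by
      rw [← hNsq]; exact sub_ne_zero.2 (Ne.symm hne)
    rw [hg, hh, hNsq]
    have key : (N a + ε) ^ 2 * (ε - N a) ^ 2 = (1 - N a ^ 2) ^ 2 := by
      rw [← hε2]; ring
    have hx : (N a)⁻¹ * ε - 1 = (ε - N a) / N a := by field_simp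
    rw [hx]
    field_simp
    linear_combination key
  refine ⟨⟨fun hbij h => ?_, fun h => ?_⟩, hinv⟩
  · obtain ⟨x, hx0, hx⟩ := hroot h
    exact hx0 (hbij.injective (hx.trans hf0.symm))
  · exact Finite.injective_iff_bijective.1
      (Function.LeftInverse.injective
        (g := fun y => (N (a ^ 2) / (1 - N (a ^ 2)) ^ 2) * g₂ y * h₂ y) (hinv h))
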